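/- arXiv:1905.03760 — 4 statements merged into one kernel-verified Lean document; each statement's English description precedes it below -/
import Mathlib

section
/- Let d ≥ 1, let Λ ⊆ ℝ^d be open, let F : Λ → ℝ and M : Λ → Λ be continuous, and let λ* ∈ Λ satisfy: M(λ*) = λ*, and there is an open neighborhood V ⊆ Λ of λ* such that λ* is the unique maximizer of F on V and F(M(λ)) > F(λ) for every λ ∈ V with λ ≠ λ*. Then λ* is an asymptotically stable fixed point of M; that is: (i) for every neighborhood V₁ ⊆ Λ of λ* there is a neighborhood V₂ of λ* such that M^k(λ) ∈ V₁ for all integers k ≥ 0 and all λ ∈ V₂; and (ii) there is a neighborhood W of λ* such that for every λ ∈ W, M^k(λ) → λ* as k → ∞. -/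
open Filter Topology

section StrictLyapunov

variable {X : Type*} [TopologicalSpace X]
  {V : Set X} {F : X → ℝ} {M : X → X} {a : X}

/-- A strict local maximiser of `F` fixed by an ascent map `M` has arbitrarily small
forward-invariant neighbourhoods contained in compact sets. -/
theorem exists_mapsTo_nhds_of_ascent [LocallyCompactSpace X] (hV : V ∈ 𝓝 a)
    (hF : ContinuousOn F V)
    (hM : ContinuousAt M a) (hfix : M a = a) (hmax : ∀ x ∈ V, x ≠ a → F x < F a)
    (hasc : ∀ x ∈ V, x ≠ a → F x < F (M x)) {U : Set X} (hU : U ∈ 𝓝 a) :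
    ∃ S ∈ 𝓝 a, ∃ K, IsCompact K ∧ S ⊆ K ∧ K ⊆ U ∩ V ∧ Set.MapsTo M S S := by
  obtain ⟨K, hKa, hKUV, hK⟩ := local_compact_nhds (inter_mem hU hV)
  have hMK : M ⁻¹' K ∈ 𝓝 a := hM (by rwa [hfix])
  obtain ⟨O, hOsub, hO, haO⟩ := mem_nhds_iff.1 (inter_mem hKa hMK)
  have hKV : K ⊆ V := fun x hx => (hKUV hx).2
  obtain ⟨c, hca, hc⟩ : ∃ c < F a, ∀ x ∈ K \ O, F x ≤ c := by
    rcases (K \ O).eq_empty_or_nonempty with he | hne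
    · exact ⟨F a - 1, by linarith, by simp [he]⟩
    · obtain ⟨y, hy, hymax⟩ := (hK.diff hO).exists_isMaxOn hne
        (hF.mono (Set.sdiff_subset.trans hKV))
      refine ⟨F y, hmax y (hKV hy.1) ?_, fun x hx => hymax hx⟩
      rintro rfl
      exact hy.2 haO
  refine ⟨{x | x ∈ K ∧ c < F x}, ?_, K, hK, fun x hx => hx.1, hKUV, ?_⟩
  · exact inter_mem hKa ((hF.continuousAt hV).eventually (lt_mem_nhds hca))
  · rintro x ⟨hxK, hcx⟩
    have hxO : x ∈ O := by
      by_contra hx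
      exact absurd (hc x ⟨hxK, hx⟩) (not_le.2 hcx)
    refine ⟨(hOsub hxO).2, ?_⟩
    rcases eq_or_ne x a with rfl | hxa
    · rwa [hfix]
    · exact hcx.trans (hasc x (hKV hxK) hxa)

/-- An orbit of an ascent map that stays in a compact set on which the strict maximiser of `F`
is `a` visits every neighbourhood of `a`. -/
theorem exists_iterate_mem_of_ascent {K : Set X} (hK : IsCompact K) (hF : ContinuousOn F K)
    (hFM : ContinuousOn (fun x => F (M x)) K) (hmax : ∀ x ∈ K, x ≠ a → F x < F a)
    (hasc : ∀ x ∈ K, x ≠ a → F x < F (M x)) {S : Set X} (hS : S ∈ 𝓝 a) {x : X}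
    (hx : ∀ k, M^[k] x ∈ K) : ∃ k, M^[k] x ∈ S := by
  by_contra! hnot
  have hmem : ∀ k, M^[k] x ∈ K \ interior S := fun k =>
    ⟨hx k, fun h => hnot k (interior_subset h)⟩
  have hne : ∀ y ∈ K \ interior S, y ≠ a := by
    rintro y hy rfl
    exact hy.2 (mem_interior_iff_mem_nhds.2 hS)
  obtain ⟨y, hy, hymin⟩ := (hK.diff isOpen_interior).exists_isMinOn ⟨_, hmem 0⟩
    ((hFM.sub hF).mono Set.sdiff_subset)
  have hpos : 0 < F (M y) - F y := sub_pos.2 (hasc y hy.1 (hne y hy))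
  have hgrow : ∀ k : ℕ, F x + k * (F (M y) - F y) ≤ F (M^[k] x) := by
    intro k
    induction k with
    | zero => simp
    | succ k ih =>
      have h : F (M y) - F y ≤ F (M (M^[k] x)) - F (M^[k] x) := hymin (hmem k)
      rw [Function.iterate_succ_apply']
      push_cast
      linarith
  obtain ⟨n, hn⟩ := exists_nat_gt ((F a - F x) / (F (M y) - F y))
  rw [div_lt_iff₀ hpos] at hn
  linarith [hgrow n, hmax _ (hx n) (hne _ (hmem n))]

end StrictLyapunov

/-- Lemma 1 of the paper: an isolated local maximiser of the objective `F` that is a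
fixed point of the continuous ascent map `M` is an asymptotically stable fixed point. -/
theorem mc_cavi_stmt0 (d : ℕ) (hd : 1 ≤ d)
    (Λ : Set (EuclideanSpace ℝ (Fin d))) (hΛopen : IsOpen Λ)
    (F : EuclideanSpace ℝ (Fin d) → ℝ)
    (M : EuclideanSpace ℝ (Fin d) → EuclideanSpace ℝ (Fin d))
    (hFcont : ContinuousOn F Λ) (hMcont : ContinuousOn M Λ)
    (hMmaps : Set.MapsTo M Λ Λ)
    (lamstar : EuclideanSpace ℝ (Fin d)) (hlamstar : lamstar ∈ Λ)
    (hfix : M lamstar = lamstar)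
    (V : Set (EuclideanSpace ℝ (Fin d))) (hVopen : IsOpen V)
    (hVsub : V ⊆ Λ) (hlamV : lamstar ∈ V)
    (hmax : ∀ lam ∈ V, lam ≠ lamstar → F lam < F lamstar)
    (hascent : ∀ lam ∈ V, lam ≠ lamstar → F lam < F (M lam)) :
    (∀ V₁ ∈ 𝓝 lamstar, V₁ ⊆ Λ →
      ∃ V₂ ∈ 𝓝 lamstar, ∀ k : ℕ, ∀ lam ∈ V₂, M^[k] lam ∈ V₁) ∧
    (∃ W ∈ 𝓝 lamstar, ∀ lam ∈ W,
      Tendsto (fun k : ℕ => M^[k] lam) atTop (𝓝 lamstar)) := by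
  have hV : V ∈ 𝓝 lamstar := hVopen.mem_nhds hlamV
  have hF : ContinuousOn F V := hFcont.mono hVsub
  have hM : ContinuousAt M lamstar := hMcont.continuousAt (hΛopen.mem_nhds hlamstar)
  have trap := fun (U : Set (EuclideanSpace ℝ (Fin d))) (hU : U ∈ 𝓝 lamstar) =>
    exists_mapsTo_nhds_of_ascent hV hF hM hfix hmax hascent hU
  refine ⟨fun V₁ hV₁ _ => ?_, ?_⟩
  · obtain ⟨S, hS, K, -, hSK, hKV, hmaps⟩ := trap V₁ hV₁
    exact ⟨S, hS, fun k lam hlam => (hKV (hSK (hmaps.iterate k hlam))).1⟩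
  · obtain ⟨W, hW, K, hK, hWK, hKV, hWmaps⟩ := trap V hV
    have hKV' : K ⊆ V := fun x hx => (hKV hx).2
    refine ⟨W, hW, fun lam hlam => tendsto_def.2 fun U hU => ?_⟩
    obtain ⟨S, hS, L, -, hSL, hLU, hSmaps⟩ := trap U hU
    obtain ⟨n, hn⟩ := exists_iterate_mem_of_ascent hK (hF.mono hKV')
      ((hFcont.comp hMcont hMmaps).mono (hKV'.trans hVsub))
      (fun x hx => hmax x (hKV' hx)) (fun x hx => hascent x (hKV' hx)) hS
      (fun k => hWK (hWmaps.iterate k hlam))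
    filter_upwards [eventually_ge_atTop n] with k hk
    obtain ⟨j, rfl⟩ := Nat.exists_eq_add_of_le' hk
    rw [Set.mem_preimage, Function.iterate_add_apply]
    exact (hLU (hSL (hSmaps.iterate j hn))).1
end

section
/- Let d ≥ 1, Λ ⊆ ℝ^d open, F : Λ → ℝ and M : Λ → Λ continuous, V₁ ⊆ Λ compact, λ* ∈ V₁, and suppose F(M(λ)) > F(λ) for every λ ∈ V₁ with λ ≠ λ*. Then for every ε > 0 there exist ν > 0 and k₀ ∈ ℕ such that there is no sequence λ^0, λ^1, …, λ^{k₀} of points of V₁ satisfying both |λ^{k+1} − M(λ^k)| < ν for all 0 ≤ k < k₀ and |λ^k − λ*| ≥ ε for all 0 ≤ k ≤ k₀. Equivalently, every ν-pseudo-orbit of M of length k₀ that stays in V₁ must enter the open ε-ball around λ* within k₀ steps. -/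
/-- If `M` strictly increases `F` on a compact set `K`, then there is `ν > 0` such that every step
of a `ν`-pseudo-orbit of `M` between points of `K` increases `F` by at least `ν`. -/
theorem IsCompact.exists_uniform_pseudoOrbit_ascent {X : Type*} [MetricSpace X]
    {K : Set X} (hK : IsCompact K) {F : X → ℝ} {M : X → X} (hF : ContinuousOn F K)
    (hM : ContinuousOn M K) (hascent : ∀ x ∈ K, F x < F (M x)) :
    ∃ ν > 0, ∀ x ∈ K, ∀ y ∈ K, dist y (M x) < ν → F x + ν ≤ F y := by
  have hcont : ContinuousOn (fun p : X × X => max (dist p.2 (M p.1)) (F p.2 - F p.1))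
      (K ×ˢ K) := by
    have hfst : Set.MapsTo Prod.fst (K ×ˢ K) K := fun p hp => hp.1
    have hsnd : Set.MapsTo Prod.snd (K ×ˢ K) K := fun p hp => hp.2
    exact ContinuousOn.sup
      (continuous_dist.comp_continuousOn
        (continuousOn_snd.prodMk (hM.comp continuousOn_fst hfst)))
      ((hF.comp continuousOn_snd hsnd).sub (hF.comp continuousOn_fst hfst))
  obtain ⟨ν, hν, hle⟩ := (hK.prod hK).exists_forall_le' hcont (a := 0) (by
    rintro ⟨x, y⟩ ⟨hx, -⟩
    by_cases hy : y = M x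
    · exact lt_max_of_lt_right (sub_pos.2 (hy ▸ hascent x hx))
    · exact lt_max_of_lt_left (dist_pos.2 hy))
  refine ⟨ν, hν, fun x hx y hy hxy => ?_⟩
  rcases le_max_iff.1 (hle (x, y) ⟨hx, hy⟩) with h | h
  · exact absurd h hxy.not_ge
  · linarith

/-- If `M` strictly increases `F` on a compact set `K`, then all pseudo-orbits of `M` of sufficient
precision leave `K` within a uniformly bounded number of steps. -/
theorem IsCompact.exists_pseudoOrbit_exit {X : Type*} [MetricSpace X]
    {K : Set X} (hK : IsCompact K) {F : X → ℝ} {M : X → X} (hF : ContinuousOn F K)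
    (hM : ContinuousOn M K) (hascent : ∀ x ∈ K, F x < F (M x)) :
    ∃ ν > 0, ∃ n : ℕ, ∀ u : ℕ → X, (∀ k < n, dist (u (k + 1)) (M (u k)) < ν) →
      ∃ k ≤ n, u k ∉ K := by
  obtain ⟨ν, hν, hstep⟩ := hK.exists_uniform_pseudoOrbit_ascent hF hM hascent
  obtain ⟨C, hC⟩ := hK.exists_bound_of_continuousOn hF
  obtain ⟨n, hn⟩ := exists_nat_gt (2 * C / ν)
  refine ⟨ν, hν, n, fun u hu => ?_⟩
  by_contra! hmem
  have hgrow : ∀ k ≤ n, F (u 0) + k * ν ≤ F (u k) := by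
    intro k
    induction k with
    | zero => simp
    | succ k ih =>
      intro hk
      have := hstep _ (hmem k (by lia)) _ (hmem (k + 1) hk) (hu k hk)
      have := ih (by lia)
      push_cast
      linarith
  have h0 := abs_le.1 (hC _ (hmem 0 n.zero_le))
  have h1 := abs_le.1 (hC _ (hmem n le_rfl))
  have := (div_lt_iff₀ hν).1 hn
  linarith [hgrow n le_rfl, h0.1, h1.2]


/-- Deterministic core of the proof of Theorem 1: every `ν`-pseudo-orbit of the strict
ascent map `M` that stays in the compact set `V₁` must enter the open `ε`-ball around
`λ*` within `k₀` steps. -/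
theorem mc_cavi_stmt8 (d : ℕ) (hd : 1 ≤ d)
    (Λ : Set (EuclideanSpace ℝ (Fin d))) (hΛopen : IsOpen Λ)
    (F : EuclideanSpace ℝ (Fin d) → ℝ)
    (M : EuclideanSpace ℝ (Fin d) → EuclideanSpace ℝ (Fin d))
    (hFcont : ContinuousOn F Λ) (hMcont : ContinuousOn M Λ)
    (hMmaps : Set.MapsTo M Λ Λ)
    (V₁ : Set (EuclideanSpace ℝ (Fin d))) (hV₁sub : V₁ ⊆ Λ) (hV₁cpt : IsCompact V₁)
    (lamstar : EuclideanSpace ℝ (Fin d)) (hlamstar : lamstar ∈ V₁)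
    (hascent : ∀ lam ∈ V₁, lam ≠ lamstar → F lam < F (M lam)) :
    ∀ ε > (0 : ℝ), ∃ ν > (0 : ℝ), ∃ k₀ : ℕ,
      ¬ ∃ lam : ℕ → EuclideanSpace ℝ (Fin d),
          (∀ k ≤ k₀, lam k ∈ V₁) ∧
          (∀ k < k₀, dist (lam (k + 1)) (M (lam k)) < ν) ∧
          (∀ k ≤ k₀, ε ≤ dist (lam k) lamstar) := by
  intro ε hε
  have hK : IsCompact (V₁ ∩ {x | ε ≤ dist x lamstar}) :=
    hV₁cpt.inter_right (isClosed_le continuous_const (continuous_id.dist continuous_const))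
  have hKsub : V₁ ∩ {x | ε ≤ dist x lamstar} ⊆ Λ := Set.inter_subset_left.trans hV₁sub
  obtain ⟨ν, hν, n, hexit⟩ := hK.exists_pseudoOrbit_exit (hFcont.mono hKsub) (hMcont.mono hKsub)
    fun x hx => hascent x hx.1 (dist_pos.1 (hε.trans_le hx.2))
  refine ⟨ν, hν, n, ?_⟩
  rintro ⟨lam, hmem, hstep, hfar⟩
  obtain ⟨k, hk, hkK⟩ := hexit lam hstep
  exact hkK ⟨hmem k hk, hfar k hk⟩
end

section
/- Let μ₁, μ₂ be σ-finite measures on measurable spaces Z₁, Z₂, and f : Z₁ × Z₂ → (0,∞) measurable. Let q₂ be a probability density with respect to μ₂ with ∫ q₂ |log q₂| dμ₂ < ∞. Define h(z₁) := ∫ q₂(z₂) log f(z₁,z₂) dμ₂(z₂), assume Z⋆ := ∫ exp(h) dμ₁ ∈ (0,∞) and ∫ exp(h(z₁)) |h(z₁)| dμ₁(z₁) < ∞, and set q₁⋆ := exp(h)/Z⋆. Then for every probability density q₁ with respect to μ₁ satisfying ∫∫ q₁ q₂ |log f| dμ₁ dμ₂ < ∞ and ∫ q₁ |log q₁| dμ₁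 < ∞, one has ELBO(q₁⋆, q₂) ≥ ELBO(q₁, q₂), with equality if and only if q₁ = q₁⋆ μ₁-almost everywhere. In particular, a single CAVI coordinate update never decreases the ELBO. -/
open MeasureTheory

/-- The mean-field ELBO of the product density `r(z₁) q₂(z₂)`:
`∫∫ r q₂ log f dμ₂ dμ₁ − ∫ r log r dμ₁ − ∫ q₂ log q₂ dμ₂`. -/
noncomputable def meanFieldELBO {Z₁ Z₂ : Type*} [MeasurableSpace Z₁] [MeasurableSpace Z₂]
    (μ₁ : Measure Z₁) (μ₂ : Measure Z₂) (f : Z₁ × Z₂ → ℝ)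
    (q₂ : Z₂ → ℝ) (r : Z₁ → ℝ) : ℝ :=
  (∫ z₁, (∫ z₂, r z₁ * q₂ z₂ * Real.log (f (z₁, z₂)) ∂μ₂) ∂μ₁)
    - (∫ z₁, r z₁ * Real.log (r z₁) ∂μ₁)
    - ∫ z₂, q₂ z₂ * Real.log (q₂ z₂) ∂μ₂

/-- The pointwise gap in the Gibbs inequality is nonnegative. -/
lemma gibbs_gap_nonneg {q r : ℝ} (hq : 0 ≤ q) (hr : 0 < r) :
    0 ≤ r - q - (q * Real.log r - q * Real.log q) := by
  rcases hq.eq_or_lt with rfl | hq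
  · simpa using hr.le
  · have hlog := mul_le_mul_of_nonneg_left (Real.log_le_sub_one_of_pos (div_pos hr hq)) hq.le
    rw [Real.log_div hr.ne' hq.ne', mul_sub, mul_sub, mul_div_cancel₀ _ hq.ne'] at hlog
    linarith

/-- The pointwise gap in the Gibbs inequality vanishes only on the diagonal. -/
lemma gibbs_gap_eq_zero_iff {q r : ℝ} (hq : 0 ≤ q) (hr : 0 < r) :
    r - q - (q * Real.log r - q * Real.log q) = 0 ↔ q = r := by
  refine ⟨fun hgap => ?_, fun hqr => by simp [hqr]⟩
  rcases hq.eq_or_lt with rfl | hq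
  · simpa using hgap.symm
  · by_contra hne
    have hdiv : r / q ≠ 1 := fun hd => hne ((div_eq_one_iff_eq hq.ne').1 hd).symm
    have hlog := mul_lt_mul_of_pos_left (Real.log_lt_sub_one_of_pos (div_pos hr hq) hdiv) hq
    rw [Real.log_div hr.ne' hq.ne', mul_sub, mul_sub, mul_div_cancel₀ _ hq.ne'] at hlog
    linarith

/-- The Gibbs inequality for densities of equal mass, with its equality case. -/
lemma gibbs_inequality {Z : Type*} [MeasurableSpace Z] {μ : Measure Z} {q r : Z → ℝ}
    (hq0 : ∀ z, 0 ≤ q z) (hr0 : ∀ z, 0 < r z) (hq : Integrable q μ) (hr : Integrable r μ)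
    (hmass : (∫ z, q z ∂μ) = ∫ z, r z ∂μ)
    (hqr : Integrable (fun z => q z * Real.log (r z)) μ)
    (hqq : Integrable (fun z => q z * Real.log (q z)) μ) :
    (∫ z, q z * Real.log (r z) ∂μ) ≤ (∫ z, q z * Real.log (q z) ∂μ) ∧
      ((∫ z, q z * Real.log (r z) ∂μ) = (∫ z, q z * Real.log (q z) ∂μ) ↔ q =ᵐ[μ] r) := by
  set G : Z → ℝ := fun z => r z - q z - (q z * Real.log (r z) - q z * Real.log (q z))
  have hG0 : 0 ≤ G := fun z => gibbs_gap_nonneg (hq0 z) (hr0 z)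
  have hGint : Integrable G μ := (hr.sub hq).sub (hqr.sub hqq)
  have hGval : (∫ z, G z ∂μ)
      = (∫ z, q z * Real.log (q z) ∂μ) - ∫ z, q z * Real.log (r z) ∂μ := by
    have hsplit := integral_sub (hr.sub hq) (hqr.sub hqq)
    simp only [Pi.sub_apply] at hsplit
    rw [hsplit, integral_sub hr hq, integral_sub hqr hqq, hmass]
    ring
  refine ⟨by linarith [hGval ▸ integral_nonneg hG0], ?_⟩
  have hGzero := integral_eq_zero_iff_of_nonneg hG0 hGint
  rw [hGval, sub_eq_zero, eq_comm] at hGzero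
  rw [hGzero]
  exact Filter.eventually_congr
    (Filter.Eventually.of_forall fun z => gibbs_gap_eq_zero_iff (hq0 z) (hr0 z))

/-- The mean-field ELBO in terms of the expected log-density `h`. -/
lemma meanFieldELBO_eq {Z₁ Z₂ : Type*} [MeasurableSpace Z₁] [MeasurableSpace Z₂]
    (μ₁ : Measure Z₁) (μ₂ : Measure Z₂) (f : Z₁ × Z₂ → ℝ) (q₂ : Z₂ → ℝ) (r h : Z₁ → ℝ)
    (hdef : ∀ z₁, h z₁ = ∫ z₂, q₂ z₂ * Real.log (f (z₁, z₂)) ∂μ₂) :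
    meanFieldELBO μ₁ μ₂ f q₂ r = (∫ z, r z * h z ∂μ₁) - (∫ z, r z * Real.log (r z) ∂μ₁)
      - ∫ z₂, q₂ z₂ * Real.log (q₂ z₂) ∂μ₂ := by
  simp only [meanFieldELBO, mul_assoc, integral_const_mul, ← hdef]

/-- A single CAVI coordinate update never decreases the ELBO: with `q₂` held fixed,
`q₁⋆ = exp(h)/Z⋆` (where `h(z₁) = ∫ q₂ log f(z₁,·) dμ₂`) maximizes `q₁ ↦ ELBO(q₁, q₂)`,
and is the unique maximizer up to `μ₁`-null sets. -/
theorem mc_cavi_stmt13 {Z₁ Z₂ : Type*} [MeasurableSpace Z₁] [MeasurableSpace Z₂]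
    (μ₁ : Measure Z₁) (μ₂ : Measure Z₂) [SigmaFinite μ₁] [SigmaFinite μ₂]
    (f : Z₁ × Z₂ → ℝ) (hfmeas : Measurable f) (hfpos : ∀ zz, 0 < f zz)
    (q₂ : Z₂ → ℝ) (hq₂meas : Measurable q₂) (hq₂0 : ∀ z, 0 ≤ q₂ z)
    (hq₂norm : (∫ z, q₂ z ∂μ₂) = 1)
    (hq₂logq₂ : Integrable (fun z => q₂ z * Real.log (q₂ z)) μ₂)
    (h : Z₁ → ℝ) (hdef : ∀ z₁, h z₁ = ∫ z₂, q₂ z₂ * Real.log (f (z₁, z₂)) ∂μ₂)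
    (Zstar : ℝ) (hZdef : Zstar = ∫ z₁, Real.exp (h z₁) ∂μ₁)
    (hZint : Integrable (fun z₁ => Real.exp (h z₁)) μ₁) (hZpos : 0 < Zstar)
    (hZh : Integrable (fun z₁ => Real.exp (h z₁) * h z₁) μ₁) :
    ∀ q₁ : Z₁ → ℝ, Measurable q₁ → (∀ z, 0 ≤ q₁ z) → (∫ z, q₁ z ∂μ₁) = 1 →
      Integrable (fun zz : Z₁ × Z₂ => q₁ zz.1 * q₂ zz.2 * Real.log (f zz)) (μ₁.prod μ₂) →
      Integrable (fun z => q₁ z * Real.log (q₁ z)) μ₁ →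
      meanFieldELBO μ₁ μ₂ f q₂ q₁
          ≤ meanFieldELBO μ₁ μ₂ f q₂ (fun z₁ => Real.exp (h z₁) / Zstar) ∧
      (meanFieldELBO μ₁ μ₂ f q₂ q₁
            = meanFieldELBO μ₁ μ₂ f q₂ (fun z₁ => Real.exp (h z₁) / Zstar) ↔
        q₁ =ᵐ[μ₁] fun z₁ => Real.exp (h z₁) / Zstar) := by
  intro q₁ _ hq₁0 hq₁norm hq₁f hq₁log
  have hq₁int : Integrable q₁ μ₁ :=
    Integrable.of_integral_ne_zero (by rw [hq₁norm]; exact one_ne_zero)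
  have hq₁h : Integrable (fun z => q₁ z * h z) μ₁ := by
    simpa only [mul_assoc, integral_const_mul, ← hdef] using hq₁f.integral_prod_left
  set r : Z₁ → ℝ := fun z => Real.exp (h z) / Zstar with hr
  have hr0 : ∀ z, 0 < r z := fun z => div_pos (Real.exp_pos _) hZpos
  have hrint : Integrable r μ₁ := hZint.div_const _
  have hrnorm : (∫ z, r z ∂μ₁) = 1 := by
    rw [hr, integral_div, ← hZdef, div_self hZpos.ne']
  have hlogr : ∀ z, Real.log (r z) = h z - Real.log Zstar := fun z => by
    rw [hr, Real.log_div (Real.exp_pos _).ne' hZpos.ne', Real.log_exp]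
  have hrh : Integrable (fun z => r z * h z) μ₁ := by
    simpa only [hr, div_mul_eq_mul_div] using hZh.div_const Zstar
  have hcross : ∀ s : Z₁ → ℝ, Integrable s μ₁ → Integrable (fun z => s z * h z) μ₁ →
      (∫ z, s z ∂μ₁) = 1 → Integrable (fun z => s z * Real.log (r z)) μ₁ ∧
        (∫ z, s z * Real.log (r z) ∂μ₁) = (∫ z, s z * h z ∂μ₁) - Real.log Zstar := by
    intro s hs hsh hsnorm
    simp only [hlogr, mul_sub]
    refine ⟨hsh.sub (hs.mul_const _), ?_⟩
    rw [integral_sub hsh (hs.mul_const _), integral_mul_const, hsnorm, one_mul]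
  obtain ⟨hq₁r, hq₁val⟩ := hcross q₁ hq₁int hq₁h hq₁norm
  obtain ⟨-, hrval⟩ := hcross r hrint hrh hrnorm
  obtain ⟨hle, heq⟩ := gibbs_inequality hq₁0 hr0 hq₁int hrint (hq₁norm.trans hrnorm.symm)
    hq₁r hq₁log
  rw [meanFieldELBO_eq μ₁ μ₂ f q₂ q₁ h hdef, meanFieldELBO_eq μ₁ μ₂ f q₂ r h hdef, ← heq]
  exact ⟨by linarith, fun _ => by linarith, fun _ => by linarith⟩
end

section
/- Let μ be a σ-finite measure on a measurable space Z, p : Z → (0,∞) measurable, I ⊆ ℝ an open interval, and q : Z × I → (0,∞) measurable with ∫ q(z,λ) dμ(z) = 1 for every λ ∈ I. Fix λ₀ ∈ I and assume: (a) for μ-a.e. z, λ ↦ q(z,λ) is differentiable on I with derivative ∂_λ q(z,λ); (b) there is a μ-integrable function g and a neighborhood J ⊆ I of λ₀ such that |∂_λ q(z,λ)| · (1 + |log p(z)| + |log q(z,λ)|) ≤ g(z) for all λ ∈ J and μ-a.e. z; (c) ∫ q(z,λ₀)(|log p(z)| + |log q(z,λ₀)|) dμ(z) < ∞. Then λ ↦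 ELBO(λ) := ∫ q(z,λ)(log p(z) − log q(z,λ)) dμ(z) is differentiable at λ₀ with derivative ELBO'(λ₀) = ∫ q(z,λ₀) · (∂_λ q(z,λ₀)/q(z,λ₀)) · (log p(z) − log q(z,λ₀)) dμ(z). -/
open MeasureTheory Filter Topology

/-- The pointwise derivative in the parameter of a family of measurable functions is measurable. -/
lemma aestronglyMeasurable_of_ae_hasDerivAt {Z : Type*} [MeasurableSpace Z] {μ : Measure Z}
    {F : ℝ → Z → ℝ} {f' : Z → ℝ} {x : ℝ} (hF : ∀ y, AEStronglyMeasurable (F y) μ)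
    (hderiv : ∀ᵐ z ∂μ, HasDerivAt (F · z) (f' z) x) : AEStronglyMeasurable f' μ := by
  refine aestronglyMeasurable_of_tendsto_ae (𝓝[≠] x)
    (f := fun y z => (y - x)⁻¹ * (F y z - F x z)) (fun y => ((hF y).sub (hF x)).const_mul _) ?_
  filter_upwards [hderiv] with z hz
  exact hasDerivAt_iff_tendsto_slope.1 hz

/-- The derivative of `x ↦ x * (c - log x)` along a differentiable positive function. -/
lemma HasDerivAt.mul_const_sub_log {f : ℝ → ℝ} {f' x : ℝ} (c : ℝ) (hf : HasDerivAt f f' x)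
    (hx : f x ≠ 0) :
    HasDerivAt (fun t => f t * (c - Real.log (f t))) (f' * (c - Real.log (f x)) - f') x := by
  refine (hf.mul ((hf.log hx).const_sub c)).congr_deriv ?_
  field_simp
  ring

/-- If a dominated differentiable family of functions has constant integral, the derivative
integrates to zero. -/
lemma integrable_and_integral_eq_zero_of_integral_const {Z : Type*} [MeasurableSpace Z]
    {μ : Measure Z} {F F' : ℝ → Z → ℝ} {bound : Z → ℝ} {s : Set ℝ} {x c : ℝ} (hs : s ∈ 𝓝 x)
    (hF : ∀ y, AEStronglyMeasurable (F y) μ) (hFx : Integrable (F x) μ)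
    (hbound : ∀ᵐ z ∂μ, ∀ y ∈ s, ‖F' y z‖ ≤ bound z) (hint : Integrable bound μ)
    (hderiv : ∀ᵐ z ∂μ, ∀ y ∈ s, HasDerivAt (F · z) (F' y z) y)
    (hconst : ∀ y ∈ s, ∫ z, F y z ∂μ = c) :
    Integrable (F' x) μ ∧ ∫ z, F' x z ∂μ = 0 := by
  have hmeas : AEStronglyMeasurable (F' x) μ := aestronglyMeasurable_of_ae_hasDerivAt hF
    (hderiv.mono fun z hz => hz x (mem_of_mem_nhds hs))
  obtain ⟨hF', hd⟩ := hasDerivAt_integral_of_dominated_loc_of_deriv_le hs (.of_forall hF) hFx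
    hmeas hbound hint hderiv
  refine ⟨hF', hd.unique ((hasDerivAt_const x c).congr_of_eventuallyEq ?_)⟩
  filter_upwards [hs] with y hy using hconst y hy

/-- Score-function (REINFORCE) gradient identity, equation (5) of the paper: under
domination conditions allowing differentiation under the integral sign, the derivative of
`λ ↦ ELBO(λ) = ∫ q(z,λ)(log p(z) − log q(z,λ)) dμ` at `λ₀` equals
`∫ q(z,λ₀) ∂_λ log q(z,λ₀) (log p(z) − log q(z,λ₀)) dμ`. -/
theorem mc_cavi_stmt14 {Z : Type*} [MeasurableSpace Z] (μ : Measure Z) [SigmaFinite μ]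
    (p : Z → ℝ) (hpmeas : Measurable p) (hppos : ∀ z, 0 < p z)
    (a b : ℝ) (I : Set ℝ) (hI : I = Set.Ioo a b)
    (q q' : Z → ℝ → ℝ)
    (hqmeas : Measurable fun zl : Z × ℝ => q zl.1 zl.2)
    (hqpos : ∀ z : Z, ∀ lam ∈ I, 0 < q z lam)
    (hqnorm : ∀ lam ∈ I, (∫ z, q z lam ∂μ) = 1)
    (lam₀ : ℝ) (hlam₀ : lam₀ ∈ I)
    -- (a) a.e. differentiability in the parameter
    (hderiv : ∀ᵐ z ∂μ, ∀ lam ∈ I, HasDerivAt (fun t => q z t) (q' z lam) lam)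
    -- (b) domination on a neighborhood of lam₀
    (g : Z → ℝ) (hg : Integrable g μ)
    (J : Set ℝ) (hJ : J ∈ 𝓝 lam₀) (hJI : J ⊆ I)
    (hbound : ∀ᵐ z ∂μ, ∀ lam ∈ J,
      |q' z lam| * (1 + |Real.log (p z)| + |Real.log (q z lam)|) ≤ g z)
    -- (c) integrability at lam₀
    (hint : Integrable
      (fun z => q z lam₀ * (|Real.log (p z)| + |Real.log (q z lam₀)|)) μ) :
    HasDerivAt
      (fun lam => ∫ z, q z lam * (Real.log (p z) - Real.log (q z lam)) ∂μ)
      (∫ z, q z lam₀ * (q' z lam₀ / q z lam₀)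
          * (Real.log (p z) - Real.log (q z lam₀)) ∂μ)
      lam₀ := by
  have hq (lam : ℝ) : Measurable fun z => q z lam :=
    hqmeas.comp (measurable_id.prodMk measurable_const)
  have hF (lam : ℝ) : Measurable fun z => q z lam * (Real.log (p z) - Real.log (q z lam)) :=
    (hq lam).mul (hpmeas.log.sub (hq lam).log)
  have hderivJ : ∀ᵐ z ∂μ, ∀ lam ∈ J, HasDerivAt (fun t => q z t) (q' z lam) lam :=
    hderiv.mono fun z hz lam hlam => hz lam (hJI hlam)
  have hqint : Integrable (fun z => q z lam₀) μ := by
    by_contra h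
    simpa [integral_undef h] using hqnorm lam₀ hlam₀
  obtain ⟨hq'int, hq'zero⟩ := integrable_and_integral_eq_zero_of_integral_const
    (F := fun lam z => q z lam) (F' := fun lam z => q' z lam) hJ
    (fun lam => (hq lam).aestronglyMeasurable) hqint
    (by
      filter_upwards [hbound] with z hz lam hlam
      refine le_trans (le_mul_of_one_le_right (abs_nonneg _) ?_) (hz lam hlam)
      linarith [abs_nonneg (Real.log (p z)), abs_nonneg (Real.log (q z lam))])
    hg hderivJ (fun lam hlam => hqnorm lam (hJI hlam))
  have hFint : Integrable
      (fun z => q z lam₀ * (Real.log (p z) - Real.log (q z lam₀))) μ := by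
    refine hint.mono' (hF lam₀).aestronglyMeasurable (.of_forall fun z => ?_)
    rw [Real.norm_eq_abs, abs_mul, abs_of_pos (hqpos z lam₀ hlam₀)]
    exact mul_le_mul_of_nonneg_left (abs_sub _ _) (hqpos z lam₀ hlam₀).le
  obtain ⟨hF'int, hmain⟩ := hasDerivAt_integral_of_dominated_loc_of_deriv_le
    (F := fun lam z => q z lam * (Real.log (p z) - Real.log (q z lam)))
    (F' := fun lam z => q' z lam * (Real.log (p z) - Real.log (q z lam)) - q' z lam)
    hJ (.of_forall fun lam => (hF lam).aestronglyMeasurable) hFint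
    ((hq'int.aestronglyMeasurable.mul
      (hpmeas.log.sub (hq lam₀).log).aestronglyMeasurable).sub hq'int.aestronglyMeasurable)
    (by
      filter_upwards [hbound] with z hz lam hlam
      refine le_trans ?_ (hz lam hlam)
      rw [← mul_sub_one, Real.norm_eq_abs, abs_mul]
      refine mul_le_mul_of_nonneg_left (abs_le.2 ⟨?_, ?_⟩) (abs_nonneg _) <;>
      linarith [neg_abs_le (Real.log (p z)), le_abs_self (Real.log (p z)),
        neg_abs_le (Real.log (q z lam)), le_abs_self (Real.log (q z lam))])
    hg
    (by
      filter_upwards [hderivJ] with z hz lam hlam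
      exact (hz lam hlam).mul_const_sub_log _ (hqpos z lam (hJI hlam)).ne')
  refine hmain.congr_deriv ?_
  have hsum := integral_add hF'int hq'int
  rw [hq'zero, add_zero] at hsum
  rw [← hsum]
  refine integral_congr_ae (.of_forall fun z => ?_)
  have := (hqpos z lam₀ hlam₀).ne'
  simp only
  field_simp
  ring
end
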